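/- Let n ≥ 2, Ω ∈ L^ρ(𝕊^{n-1}) with 1 < ρ < n and mean zero on 𝕊^{n-1}, and T_Ω the associated rough singular integral. Fix α with ρn/(ρn+ρ−n) ≤ α < n and β with 1 < α < β < n. Then for every f ∈ C_c^∞(ℝⁿ) and every x ∈ ℝⁿ: |T_Ω f(x)| ≤ C ‖Ω‖_{L^ρ(𝕊^{n-1})} ( M_B(|∇f|^α)(x) )^{1/α − 1/β} ‖∇f‖_{Ṁ^{α, αn/β}}^{α/β}, where M_B is the Hardy–Littlewood maximal function and Ṁ^{α, αn/β} the homogeneous Morrey space. -/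

import Mathlib

open MeasureTheory Metric Set ENNReal Filter

noncomputable def maximalFn (n : ℕ) (g : EuclideanSpace ℝ (Fin n) → ℝ)
    (x : EuclideanSpace ℝ (Fin n)) : ℝ≥0∞ :=
  ⨆ (z : EuclideanSpace ℝ (Fin n)) (r : ℝ) (_ : 0 < r) (_ : x ∈ ball z r),
    (volume (ball z r))⁻¹ * ∫⁻ y in ball z r, ENNReal.ofReal (|g y|)

noncomputable def morreyNorm (n : ℕ) (p q : ℝ) (f : EuclideanSpace ℝ (Fin n) → ℝ) : ℝ≥0∞ :=
  ⨆ (x : EuclideanSpace ℝ (Fin n)) (r : ℝ) (_ : 0 < r),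
    (ENNReal.ofReal (r ^ (-((n : ℝ) * (1 - p / q)))) *
      ∫⁻ y in ball x r, ENNReal.ofReal (|f y| ^ p)) ^ (1 / p)

section Poincare

open Module

variable {E : Type*} [NormedAddCommGroup E] [NormedSpace ℝ E]

theorem enorm_sub_rpow_le_lintegral_fderiv_lineMap {g : E → ℝ} (hg : ContDiff ℝ 1 g) {p : ℝ}
    (hp : 1 ≤ p) (x y : E) :
    ‖g y - g x‖ₑ ^ p ≤
      ‖y - x‖ₑ ^ p * ∫⁻ t in Icc (0 : ℝ) 1, ‖fderiv ℝ g (AffineMap.lineMap x y t)‖ₑ ^ p := by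
  have hp0 : 0 < p := by linarith
  have hγ : ContDiff ℝ 1 (fun t : ℝ => g (AffineMap.lineMap x y t)) :=
    hg.comp (ContinuousAffineMap.lineMap (R := ℝ) x y).contDiff
  have h1 := enorm_sub_le_lintegral_derivWithin_Icc_of_contDiffOn_Icc
    (hγ.contDiffOn (s := Icc 0 1)) zero_le_one
  simp only [AffineMap.lineMap_apply_one, AffineMap.lineMap_apply_zero] at h1
  have hcont : Continuous fun t : ℝ => fderiv ℝ g (AffineMap.lineMap x y t) :=
    (hg.continuous_fderiv one_ne_zero).comp AffineMap.lineMap_continuous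
  have h2 : ∫⁻ t in Icc (0 : ℝ) 1,
      ‖derivWithin (fun t : ℝ => g (AffineMap.lineMap x y t)) (Icc 0 1) t‖ₑ ≤
      ‖y - x‖ₑ * ∫⁻ t in Icc (0 : ℝ) 1, ‖fderiv ℝ g (AffineMap.lineMap x y t)‖ₑ := by
    rw [← lintegral_const_mul' _ _ enorm_ne_top]
    refine setLIntegral_mono' measurableSet_Icc fun t ht => ?_
    have hd : HasDerivAt (fun t : ℝ => g (AffineMap.lineMap x y t))
        (fderiv ℝ g (AffineMap.lineMap x y t) (y - x)) t :=
      ((hg.differentiable one_ne_zero) _).hasFDerivAt.comp_hasDerivAt t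
        AffineMap.hasDerivAt_lineMap
    rw [hd.hasDerivWithinAt.derivWithin (uniqueDiffOn_Icc zero_lt_one t ht), mul_comm]
    exact ContinuousLinearMap.le_opENorm _ _
  have hprob : IsProbabilityMeasure (volume.restrict (Icc (0 : ℝ) 1)) := ⟨by simp⟩
  have h3 := eLpNorm'_le_eLpNorm'_of_exponent_le (μ := volume.restrict (Icc (0 : ℝ) 1))
    zero_lt_one hp hcont.aestronglyMeasurable
  simp only [eLpNorm', rpow_one, div_one] at h3
  calc ‖g y - g x‖ₑ ^ p
      ≤ (‖y - x‖ₑ * (∫⁻ t in Icc (0 : ℝ) 1,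
          ‖fderiv ℝ g (AffineMap.lineMap x y t)‖ₑ ^ p) ^ (1 / p)) ^ p := by
        gcongr
        exact (h1.trans h2).trans (by gcongr)
    _ = _ := by
        rw [ENNReal.mul_rpow_of_nonneg _ _ hp0.le, ← ENNReal.rpow_mul,
          one_div_mul_cancel hp0.ne', ENNReal.rpow_one]

variable [MeasurableSpace E] [BorelSpace E] [FiniteDimensional ℝ E] (μ : Measure E)
  [μ.IsAddHaarMeasure]

theorem lintegral_comp_smul_addHaar {h : E → ℝ≥0∞} (hh : Measurable h) {r : ℝ} (hr : r ≠ 0) :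
    ∫⁻ y, h (r • y) ∂μ = ENNReal.ofReal |(r ^ finrank ℝ E)⁻¹| * ∫⁻ y, h y ∂μ := by
  rw [← lintegral_map hh (measurable_const_smul r), Measure.map_addHaar_smul μ hr,
    lintegral_smul_measure, smul_eq_mul]

theorem setLIntegral_setLIntegral_lineMap_le {B : Set E} (hB : MeasurableSet B)
    (hconv : Convex ℝ B) {h : E → ℝ≥0∞} (hh : Measurable h) {t : ℝ} (ht : t ∈ Icc (0 : ℝ) 1) :
    ∫⁻ x in B, ∫⁻ y in B, h (AffineMap.lineMap x y t) ∂μ ∂μ ≤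
      2 ^ finrank ℝ E * μ B * ∫⁻ z in B, h z ∂μ := by
  have key : ∀ s : ℝ, 1 / 2 ≤ s → s ≤ 1 →
      ∫⁻ x in B, ∫⁻ y in B, h (AffineMap.lineMap x y s) ∂μ ∂μ ≤
      2 ^ finrank ℝ E * μ B * ∫⁻ z in B, h z ∂μ := by
    intro s hs hs1
    have hs0 : 0 < s := by linarith
    have hin : ∀ x ∈ B, ∫⁻ y in B, h (AffineMap.lineMap x y s) ∂μ ≤
        2 ^ finrank ℝ E * ∫⁻ z in B, h z ∂μ := by
      intro x hx
      calc ∫⁻ y in B, h (AffineMap.lineMap x y s) ∂μ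
          ≤ ∫⁻ y in B, B.indicator h ((1 - s) • x + s • y) ∂μ := by
            refine setLIntegral_mono' hB fun y hy => ?_
            rw [AffineMap.lineMap_apply_module, indicator_of_mem]
            exact hconv hx hy (by linarith) hs0.le (by ring)
        _ ≤ ∫⁻ y, B.indicator h ((1 - s) • x + s • y) ∂μ := setLIntegral_le_lintegral _ _
        _ = ENNReal.ofReal |(s ^ finrank ℝ E)⁻¹| * ∫⁻ y, B.indicator h ((1 - s) • x + y) ∂μ :=
            lintegral_comp_smul_addHaar μ (h := fun y => B.indicator h ((1 - s) • x + y))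
              ((hh.indicator hB).comp (measurable_const_add _)) hs0.ne'
        _ = ENNReal.ofReal |(s ^ finrank ℝ E)⁻¹| * ∫⁻ z in B, h z ∂μ := by
            rw [lintegral_add_left_eq_self (fun y => B.indicator h y), lintegral_indicator hB]
        _ ≤ 2 ^ finrank ℝ E * ∫⁻ z in B, h z ∂μ := by
            gcongr
            rw [abs_of_pos (by positivity), ← inv_pow, ENNReal.ofReal_pow (by positivity)]
            gcongr
            rw [← ENNReal.ofReal_ofNat 2]
            refine ENNReal.ofReal_le_ofReal ?_
            rw [inv_le_comm₀ hs0 two_pos]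
            linarith
    calc _ ≤ ∫⁻ _x in B, 2 ^ finrank ℝ E * ∫⁻ z in B, h z ∂μ ∂μ := setLIntegral_mono' hB hin
      _ = _ := by rw [setLIntegral_const]; ring
  rcases le_total (1 / 2) t with h2 | h2
  · exact key t h2 ht.2
  · rw [lintegral_lintegral_swap]
    · simp_rw [← AffineMap.lineMap_apply_one_sub (k := ℝ) _ _ t]
      exact key (1 - t) (by linarith) (by linarith [ht.1])
    · refine Measurable.aemeasurable (hh.comp ?_)
      simp only [AffineMap.lineMap_apply_module]
      fun_prop

theorem exists_setLIntegral_enorm_sub_rpow_le {g : E → ℝ} (hg : ContDiff ℝ 1 g) {p : ℝ}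
    (hp : 1 ≤ p) (z : E) {R : ℝ} (hR : 0 < R) :
    ∃ c, ∫⁻ x in ball z R, ‖g x - c‖ₑ ^ p ∂μ ≤
      ENNReal.ofReal (2 * R) ^ p * 2 ^ finrank ℝ E *
        ∫⁻ x in ball z R, ‖fderiv ℝ g x‖ₑ ^ p ∂μ := by
  have hp0 : 0 < p := by linarith
  set B := ball z R with hBdef
  have hB : MeasurableSet B := measurableSet_ball
  have hB0 : μ B ≠ 0 := (measure_ball_pos μ z hR).ne'
  have hBt : μ B ≠ ∞ := measure_ball_lt_top.ne
  have hm : Measurable fun x => ‖fderiv ℝ g x‖ₑ ^ p :=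
    ((hg.continuous_fderiv one_ne_zero).enorm.measurable).pow_const p
  have hgc := hg.continuous
  have hF : Measurable fun q : E × E => ‖g q.2 - g q.1‖ₑ ^ p :=
    (Continuous.enorm (by fun_prop)).measurable.pow_const p
  obtain ⟨x, -, hx⟩ := exists_le_setLAverage hB0 hBt
    (hF.lintegral_prod_right' (ν := μ.restrict B)).aemeasurable
  refine ⟨g x, hx.trans ?_⟩
  rw [setLAverage_eq]
  refine ENNReal.div_le_of_le_mul ?_
  calc ∫⁻ x in B, ∫⁻ y in B, ‖g y - g x‖ₑ ^ p ∂μ ∂μ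
      ≤ ∫⁻ x in B, ∫⁻ y in B, ENNReal.ofReal (2 * R) ^ p *
          ∫⁻ t in Icc (0 : ℝ) 1, ‖fderiv ℝ g (AffineMap.lineMap x y t)‖ₑ ^ p ∂volume ∂μ ∂μ := by
        refine setLIntegral_mono' hB fun x hx => setLIntegral_mono' hB fun y hy => ?_
        refine (enorm_sub_rpow_le_lintegral_fderiv_lineMap hg hp x y).trans ?_
        gcongr
        rw [← ofReal_norm, ← dist_eq_norm]
        refine ENNReal.ofReal_le_ofReal ?_
        rw [hBdef, mem_ball] at hx hy
        linarith [dist_triangle_right y x z]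
    _ = ENNReal.ofReal (2 * R) ^ p * ∫⁻ t in Icc (0 : ℝ) 1, ∫⁻ x in B, ∫⁻ y in B,
          ‖fderiv ℝ g (AffineMap.lineMap x y t)‖ₑ ^ p ∂μ ∂μ ∂volume := by
        have hc : ENNReal.ofReal (2 * R) ^ p ≠ ∞ :=
          ENNReal.rpow_ne_top_of_nonneg hp0.le ENNReal.ofReal_ne_top
        have hmeas : Measurable fun q : (E × ℝ) × E =>
            ‖fderiv ℝ g (AffineMap.lineMap q.1.1 q.2 q.1.2)‖ₑ ^ p := by
          refine hm.comp ?_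
          simp only [AffineMap.lineMap_apply_module]
          fun_prop
        have h1 : ∀ x, ∫⁻ y in B, ENNReal.ofReal (2 * R) ^ p *
            ∫⁻ t in Icc (0 : ℝ) 1, ‖fderiv ℝ g (AffineMap.lineMap x y t)‖ₑ ^ p ∂volume ∂μ =
            ENNReal.ofReal (2 * R) ^ p * ∫⁻ t in Icc (0 : ℝ) 1, ∫⁻ y in B,
              ‖fderiv ℝ g (AffineMap.lineMap x y t)‖ₑ ^ p ∂μ ∂volume := by
          intro x
          rw [lintegral_const_mul' _ _ hc, lintegral_lintegral_swap]
          exact (hmeas.comp (f := fun q : E × ℝ => ((x, q.2), q.1)) (by fun_prop)).aemeasurable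
        simp_rw [h1]
        rw [lintegral_const_mul' _ _ hc, lintegral_lintegral_swap]
        exact (hmeas.lintegral_prod_right' (ν := μ.restrict B)).aemeasurable
    _ ≤ ENNReal.ofReal (2 * R) ^ p * ∫⁻ _t in Icc (0 : ℝ) 1,
          2 ^ finrank ℝ E * μ B * ∫⁻ x in B, ‖fderiv ℝ g x‖ₑ ^ p ∂μ ∂volume := by
        exact mul_le_mul' le_rfl <| setLIntegral_mono' measurableSet_Icc fun t ht =>
          setLIntegral_setLIntegral_lineMap_le μ hB (convex_ball z R) hm ht
    _ = _ := by
        rw [setLIntegral_const]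
        simp
        ring

theorem exists_eLpNorm_sub_le_eLpNorm_fderiv {p : NNReal} (hp : 1 ≤ p) (z : E) {R : ℝ}
    (hR : 0 < R) :
    ∃ K : NNReal, ∀ g : E → ℝ, ContDiff ℝ 1 g → ∃ c,
      eLpNorm (fun x => g x - c) p (μ.restrict (ball z R)) ≤
        K * eLpNorm (fderiv ℝ g) p (μ.restrict (ball z R)) := by
  have hp1 : (1 : ℝ) ≤ p := mod_cast hp
  have hp0 : p ≠ 0 := (zero_lt_one.trans_le hp).ne'
  have hK : (ENNReal.ofReal (2 * R) ^ (p : ℝ) * 2 ^ finrank ℝ E) ^ (1 / (p : ℝ)) ≠ ∞ := by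
    refine ENNReal.rpow_ne_top_of_nonneg (by positivity) (ENNReal.mul_ne_top ?_ ?_)
    · exact ENNReal.rpow_ne_top_of_nonneg (by positivity) ENNReal.ofReal_ne_top
    · exact ENNReal.pow_ne_top ENNReal.ofNat_ne_top
  refine ⟨((ENNReal.ofReal (2 * R) ^ (p : ℝ) * 2 ^ finrank ℝ E) ^ (1 / (p : ℝ))).toNNReal,
    fun g hg => ?_⟩
  obtain ⟨c, hc⟩ := exists_setLIntegral_enorm_sub_rpow_le μ hg hp1 z hR
  refine ⟨c, ?_⟩
  rw [eLpNorm_eq_lintegral_rpow_enorm_toReal (by simpa) ENNReal.coe_ne_top,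
    eLpNorm_eq_lintegral_rpow_enorm_toReal (by simpa) ENNReal.coe_ne_top, ENNReal.coe_toReal]
  refine (ENNReal.rpow_le_rpow hc (by positivity)).trans ?_
  rw [ENNReal.mul_rpow_of_nonneg _ _ (by positivity), ENNReal.coe_toNNReal hK]

theorem exists_eLpNorm_sub_le_eLpNorm_fderiv_sobolev {p q : NNReal} (hp : 1 ≤ p)
    (hpn : p < finrank ℝ E) (hpq : (p : ℝ)⁻¹ - (finrank ℝ E : ℝ)⁻¹ ≤ (q : ℝ)⁻¹) :
    ∃ K : NNReal, ∀ g : E → ℝ, ContDiff ℝ 1 g → ∃ c,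
      eLpNorm (fun x => g x - c) q (μ.restrict (closedBall 0 2)) ≤
        K * eLpNorm (fderiv ℝ g) p (μ.restrict (ball 0 4)) := by
  have hp' : (1 : ℝ≥0∞) ≤ p := mod_cast hp
  obtain ⟨K₁, hK₁⟩ := exists_eLpNorm_sub_le_eLpNorm_fderiv μ hp (0 : E) (R := 4) (by norm_num)
  let φ : ContDiffBump (0 : E) := ⟨2, 3, by norm_num, by norm_num⟩
  have hφ : ContDiff ℝ 1 φ := φ.contDiff
  have hφc : HasCompactSupport φ := φ.hasCompactSupport
  have hφt : tsupport φ ⊆ ball (0 : E) 4 := by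
    rw [φ.tsupport_eq]
    exact closedBall_subset_ball (by norm_num [φ])
  obtain ⟨D, hD⟩ := (hφ.continuous_fderiv one_ne_zero).bounded_above_of_compact_support
    (hφc.fderiv ℝ)
  set S := eLpNormLESNormFDerivOfLeConst ℝ μ (ball (0 : E) 4) p q
  refine ⟨S * (1 + D.toNNReal * K₁), fun g hg => ?_⟩
  obtain ⟨c, hc⟩ := hK₁ g hg
  refine ⟨c, ?_⟩
  have hgc := hg.continuous
  set u : E → ℝ := fun x => φ x * (g x - c)
  have hu : ContDiff ℝ 1 u := hφ.mul (hg.sub contDiff_const)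
  have hus : Function.support u ⊆ ball 0 4 :=
    (Function.support_mul_subset_left _ _).trans (subset_closure.trans hφt)
  have hus' : Function.support (fderiv ℝ u) ⊆ ball 0 4 :=
    (support_fderiv_subset ℝ).trans
      ((closure_mono (Function.support_mul_subset_left _ _)).trans hφt)
  have hdu : ∀ x, ‖fderiv ℝ u x‖ ≤ ‖fderiv ℝ g x‖ + D * ‖g x - c‖ := by
    intro x
    have h1 := ((hφ.differentiable one_ne_zero x).hasFDerivAt.mul
      ((hg.differentiable one_ne_zero x).hasFDerivAt.sub_const c)).fderiv
    change fderiv ℝ u x = _ at h1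
    rw [h1]
    refine (norm_add_le _ _).trans ?_
    rw [norm_smul, norm_smul, Real.norm_of_nonneg φ.nonneg]
    refine add_le_add (mul_le_of_le_one_left (norm_nonneg _) φ.le_one) ?_
    rw [mul_comm]
    exact mul_le_mul_of_nonneg_right (hD x) (norm_nonneg _)
  have hD0 : 0 ≤ D := (norm_nonneg _).trans (hD 0)
  calc eLpNorm (fun x => g x - c) q (μ.restrict (closedBall 0 2))
      = eLpNorm u q (μ.restrict (closedBall 0 2)) := by
        refine eLpNorm_congr_ae ?_
        filter_upwards [ae_restrict_mem measurableSet_closedBall] with x hx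
        simp [u, φ.one_of_mem_closedBall hx]
    _ ≤ eLpNorm u q μ := eLpNorm_restrict_le _ _ _ _
    _ ≤ S * eLpNorm (fderiv ℝ u) p μ :=
        eLpNorm_le_eLpNorm_fderiv_of_le μ hu hus hp hpn hpq isBounded_ball
    _ ≤ S * eLpNorm ((ball 0 4).indicator fun x => ‖fderiv ℝ g x‖ + D * ‖g x - c‖) p μ := by
        gcongr
        refine eLpNorm_mono_real fun x => ?_
        by_cases hx : x ∈ ball (0 : E) 4
        · rw [indicator_of_mem hx]
          exact hdu x
        · rw [indicator_of_notMem hx, Function.notMem_support.1 fun h => hx (hus' h), norm_zero]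
    _ = S * eLpNorm (fun x => ‖fderiv ℝ g x‖ + D * ‖g x - c‖) p (μ.restrict (ball 0 4)) := by
        rw [eLpNorm_indicator_eq_eLpNorm_restrict measurableSet_ball]
    _ ≤ S * (eLpNorm (fderiv ℝ g) p (μ.restrict (ball 0 4)) +
          D.toNNReal * eLpNorm (fun x => g x - c) p (μ.restrict (ball 0 4))) := by
        gcongr
        refine (eLpNorm_add_le (f := fun x => ‖fderiv ℝ g x‖) (g := fun x => D * ‖g x - c‖)
          (hg.continuous_fderiv one_ne_zero).norm.aestronglyMeasurable
          (Continuous.aestronglyMeasurable (by fun_prop)) hp').trans ?_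
        gcongr
        · rw [eLpNorm_norm]
        · refine (eLpNorm_const_smul_le (c := D) (f := fun x => ‖g x - c‖)).trans ?_
          rw [eLpNorm_norm, Real.enorm_of_nonneg hD0]
          rfl
    _ ≤ S * (eLpNorm (fderiv ℝ g) p (μ.restrict (ball 0 4)) +
          D.toNNReal * (K₁ * eLpNorm (fderiv ℝ g) p (μ.restrict (ball 0 4)))) := by gcongr
    _ = _ := by
        push_cast
        ring

end Poincare

section Polar

open Module

variable {E : Type*} [NormedAddCommGroup E] [NormedSpace ℝ E] [MeasurableSpace E] [BorelSpace E]
  [FiniteDimensional ℝ E] [Nontrivial E] (μ : Measure E) [μ.IsAddHaarMeasure]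

theorem lintegral_mul_comp_norm_eq {w : E → ℝ≥0∞} (hw : Measurable w)
    (hw0 : ∀ c : ℝ, 0 < c → ∀ y, w (c • y) = w y) {k : ℝ → ℝ≥0∞} (hk : Measurable k) :
    ∫⁻ y, w y * k ‖y‖ ∂μ =
      (∫⁻ z : sphere (0 : E) 1, w z ∂μ.toSphere) *
        ∫⁻ r : Ioi (0 : ℝ), k r ∂(Measure.volumeIoiPow (finrank ℝ E - 1)) := by
  calc ∫⁻ y, w y * k ‖y‖ ∂μ
      = ∫⁻ y : ({(0)}ᶜ : Set E), w y * k ‖(y : E)‖ ∂(μ.comap (↑)) := by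
        rw [lintegral_subtype_comap (measurableSet_singleton _).compl fun y => w y * k ‖y‖,
          restrict_compl_singleton]
    _ = ∫⁻ y : ({(0)}ᶜ : Set E), w (homeomorphUnitSphereProd E y).1 *
          k (homeomorphUnitSphereProd E y).2 ∂(μ.comap (↑)) := by
        refine lintegral_congr fun y => ?_
        have hy : 0 < ‖(y : E)‖ := norm_pos_iff.2 y.2
        simp [hw0 _ (inv_pos.2 hy)]
    _ = ∫⁻ q : sphere (0 : E) 1 × Ioi (0 : ℝ), w q.1 * k q.2
          ∂(μ.toSphere.prod (Measure.volumeIoiPow (finrank ℝ E - 1))) :=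
        μ.measurePreserving_homeomorphUnitSphereProd.lintegral_comp (by fun_prop)
          (f := fun q => w q.1 * k q.2)
    _ = _ := lintegral_prod_mul (f := fun z : sphere (0 : E) 1 => w z)
        (g := fun r : Ioi (0 : ℝ) => k r) (by fun_prop) (by fun_prop)

theorem integral_mul_comp_norm_eq (w : E → ℝ)
    (hw0 : ∀ c : ℝ, 0 < c → ∀ y, w (c • y) = w y) (k : ℝ → ℝ) :
    ∫ y, w y * k ‖y‖ ∂μ =
      (∫ z : sphere (0 : E) 1, w z ∂μ.toSphere) *
        ∫ r : Ioi (0 : ℝ), k r ∂(Measure.volumeIoiPow (finrank ℝ E - 1)) := by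
  calc ∫ y, w y * k ‖y‖ ∂μ
      = ∫ y : ({(0)}ᶜ : Set E), w y * k ‖(y : E)‖ ∂(μ.comap (↑)) := by
        rw [integral_subtype_comap (measurableSet_singleton _).compl fun y => w y * k ‖y‖,
          restrict_compl_singleton]
    _ = ∫ y : ({(0)}ᶜ : Set E), w (homeomorphUnitSphereProd E y).1 *
          k (homeomorphUnitSphereProd E y).2 ∂(μ.comap (↑)) := by
        refine integral_congr_ae (Eventually.of_forall fun y => ?_)
        have hy : 0 < ‖(y : E)‖ := norm_pos_iff.2 y.2
        simp [hw0 _ (inv_pos.2 hy)]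
    _ = ∫ q : sphere (0 : E) 1 × Ioi (0 : ℝ), w q.1 * k q.2
          ∂(μ.toSphere.prod (Measure.volumeIoiPow (finrank ℝ E - 1))) :=
        μ.measurePreserving_homeomorphUnitSphereProd.integral_comp
          (Homeomorph.measurableEmbedding _) (fun q => w q.1 * k q.2)
    _ = _ := integral_prod_mul (fun z : sphere (0 : E) 1 => w z) (fun r : Ioi (0 : ℝ) => k r)

theorem volumeIoiPow_preimage_Ioc_lt_top (m : ℕ) (a b : ℝ) :
    Measure.volumeIoiPow m (Subtype.val ⁻¹' Ioc a b) < ∞ := by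
  refine (measure_mono (t := Iio ⟨|b| + 1, by rw [mem_Ioi]; positivity⟩) fun r hr => ?_).trans_lt
    (by rw [Measure.volumeIoiPow_apply_Iio]; exact ENNReal.ofReal_lt_top)
  rw [mem_Iio, ← Subtype.coe_lt_coe]
  exact (hr.2.trans (le_abs_self b)).trans_lt (lt_add_one _)

omit [NormedSpace ℝ E] [FiniteDimensional ℝ E] [Nontrivial E] in
theorem measurableSet_norm_preimage_Ioc (a b : ℝ) :
    MeasurableSet {y : E | ‖y‖ ∈ Ioc a b} :=
  measurable_norm measurableSet_Ioc

theorem setLIntegral_annulus_eq {w : E → ℝ≥0∞} (hw : Measurable w)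
    (hw0 : ∀ c : ℝ, 0 < c → ∀ y, w (c • y) = w y) (a b : ℝ) :
    ∫⁻ y in {y | ‖y‖ ∈ Ioc a b}, w y ∂μ =
      (∫⁻ z : sphere (0 : E) 1, w z ∂μ.toSphere) *
        Measure.volumeIoiPow (finrank ℝ E - 1) (Subtype.val ⁻¹' Ioc a b) := by
  have h := lintegral_mul_comp_norm_eq μ hw hw0 (k := (Ioc a b).indicator 1)
    (measurable_one.indicator measurableSet_Ioc)
  rw [← lintegral_indicator (measurableSet_norm_preimage_Ioc a b)]
  convert h using 2
  · ext y
    by_cases hy : ‖y‖ ∈ Ioc a b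
    · rw [indicator_of_mem (by exact hy), indicator_of_mem hy]; simp
    · rw [indicator_of_notMem (by exact hy), indicator_of_notMem hy]; simp
  · rw [← lintegral_indicator_one (measurable_subtype_coe measurableSet_Ioc)]
    rfl

theorem setIntegral_annulus_mul_comp_norm_eq_zero {w : E → ℝ}
    (hw0 : ∀ c : ℝ, 0 < c → ∀ y, w (c • y) = w y)
    (hmean : ∫ z : sphere (0 : E) 1, w z ∂μ.toSphere = 0) (k : ℝ → ℝ) (a b : ℝ) :
    ∫ y in {y | ‖y‖ ∈ Ioc a b}, w y * k ‖y‖ ∂μ = 0 := by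
  have h := integral_mul_comp_norm_eq μ w hw0 ((Ioc a b).indicator k)
  rw [hmean, zero_mul] at h
  rw [← integral_indicator (measurableSet_norm_preimage_Ioc a b), ← h]
  congr 1 with y
  by_cases hy : ‖y‖ ∈ Ioc a b
  · rw [indicator_of_mem (by exact hy), indicator_of_mem hy]
  · rw [indicator_of_notMem (by exact hy), indicator_of_notMem hy, mul_zero]

theorem integrableOn_annulus {w : E → ℝ} (hw : Measurable w)
    (hw0 : ∀ c : ℝ, 0 < c → ∀ y, w (c • y) = w y)
    (hint : Integrable (fun z : sphere (0 : E) 1 => w z) μ.toSphere) (a b : ℝ) :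
    IntegrableOn w {y | ‖y‖ ∈ Ioc a b} μ := by
  refine ⟨hw.aestronglyMeasurable, ?_⟩
  rw [HasFiniteIntegral, setLIntegral_annulus_eq μ hw.enorm fun c hc y => by rw [hw0 c hc]]
  exact ENNReal.mul_lt_top hint.2 (volumeIoiPow_preimage_Ioc_lt_top _ a b)

end Polar

section Annulus

open Module
open scoped Pointwise

variable {E : Type*} [NormedAddCommGroup E] [NormedSpace ℝ E] [MeasurableSpace E] [BorelSpace E]
  [FiniteDimensional ℝ E] [Nontrivial E] (μ : Measure E) [μ.IsAddHaarMeasure]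

theorem integrableOn_annulus_div_norm_pow_mul {w : E → ℝ} (hw : Measurable w)
    (hw0 : ∀ c : ℝ, 0 < c → ∀ y, w (c • y) = w y)
    (hint : Integrable (fun z : sphere (0 : E) 1 => w z) μ.toSphere) {g : E → ℝ}
    (hg : Continuous g) (m : ℕ) {a : ℝ} (ha : 0 < a) (b : ℝ) :
    IntegrableOn (fun y => w y / ‖y‖ ^ m * g y) {y | ‖y‖ ∈ Ioc a b} μ := by
  have hK : IsCompact (closedBall (0 : E) b ∩ {y | a ≤ ‖y‖}) :=
    (isCompact_closedBall 0 b).inter_right (isClosed_le continuous_const continuous_norm)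
  have h := (integrableOn_annulus μ hw hw0 hint a b).mul_continuousOn_of_subset
    (g' := fun y => (‖y‖ ^ m)⁻¹ * g y) (K := closedBall (0 : E) b ∩ {y | a ≤ ‖y‖}) ?_
    (measurableSet_norm_preimage_Ioc a b) hK fun y hy => ⟨by simpa using hy.2, hy.1.le⟩
  · simpa only [div_eq_mul_inv, mul_assoc] using h
  · refine ContinuousOn.mul (ContinuousOn.inv₀ (by fun_prop) fun y hy => ?_) hg.continuousOn
    exact pow_ne_zero _ (ha.trans_le hy.2).ne'

theorem exists_enorm_setIntegral_unit_annulus_le {ρ α : ℝ} (hρ : 1 < ρ) (hα : 1 ≤ α)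
    (hαn : α < finrank ℝ E) (hαρ : α⁻¹ - (finrank ℝ E : ℝ)⁻¹ ≤ 1 - ρ⁻¹) (m : ℕ) :
    ∃ C : NNReal, ∀ w : E → ℝ, Measurable w →
      (∀ c : ℝ, 0 < c → ∀ y, w (c • y) = w y) →
      Integrable (fun z : sphere (0 : E) 1 => w z) μ.toSphere →
      ∫ z : sphere (0 : E) 1, w z ∂μ.toSphere = 0 →
      ∀ g : E → ℝ, ContDiff ℝ 1 g →
      ‖∫ y in {y | ‖y‖ ∈ Ioc (1 : ℝ) 2}, w y / ‖y‖ ^ m * g y ∂μ‖ₑ ≤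
        C * (∫⁻ z : sphere (0 : E) 1, ‖w z‖ₑ ^ ρ ∂μ.toSphere) ^ (1 / ρ) *
          (∫⁻ y in ball 0 4, ‖fderiv ℝ g y‖ₑ ^ α ∂μ) ^ (1 / α) := by
  have hρ0 : 0 < ρ := by linarith
  have hα0 : 0 < α := by linarith
  have hconj : ρ.HolderConjugate ρ.conjExponent := .conjExponent hρ
  obtain ⟨K, hK⟩ := exists_eLpNorm_sub_le_eLpNorm_fderiv_sobolev μ (p := α.toNNReal)
    (q := ρ.conjExponent.toNNReal) (by simpa) (Real.toNNReal_lt_natCast'.2 ⟨hαn, finrank_pos.ne'⟩)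
    (by
      rw [Real.coe_toNNReal _ hα0.le, Real.coe_toNNReal _ hconj.symm.nonneg,
        ← hconj.one_sub_inv]
      exact hαρ)
  set V := Measure.volumeIoiPow (finrank ℝ E - 1) (Subtype.val ⁻¹' Ioc (1 : ℝ) 2) ^ (1 / ρ)
  have hV : V ≠ ∞ := ENNReal.rpow_ne_top_of_nonneg (by positivity)
    (volumeIoiPow_preimage_Ioc_lt_top _ _ _).ne
  refine ⟨V.toNNReal * K, fun w hw hw0 hint hmean g hg => ?_⟩
  obtain ⟨c, hc⟩ := hK g hg
  have hgc := hg.continuous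
  rw [ENNReal.coe_mul, ENNReal.coe_toNNReal hV]
  have hαc : ((α.toNNReal : NNReal) : ℝ) = α := Real.coe_toNNReal _ hα0.le
  have hqc : ((ρ.conjExponent.toNNReal : NNReal) : ℝ) = ρ.conjExponent :=
    Real.coe_toNNReal _ hconj.symm.nonneg
  have hα' : (α.toNNReal : ℝ≥0∞) ≠ 0 := by simpa using hα0
  have hq' : (ρ.conjExponent.toNNReal : ℝ≥0∞) ≠ 0 := by simpa using hconj.symm.pos
  rw [eLpNorm_eq_lintegral_rpow_enorm_toReal hα' ENNReal.coe_ne_top,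
    eLpNorm_eq_lintegral_rpow_enorm_toReal hq' ENNReal.coe_ne_top, ENNReal.coe_toReal,
    ENNReal.coe_toReal, hαc, hqc] at hc
  set A : Set E := {y | ‖y‖ ∈ Ioc (1 : ℝ) 2}
  have hA : MeasurableSet A := measurableSet_norm_preimage_Ioc 1 2
  have hsub : ∫ y in A, w y / ‖y‖ ^ m * g y ∂μ = ∫ y in A, w y / ‖y‖ ^ m * (g y - c) ∂μ := by
    have h0 : ∫ y in A, w y / ‖y‖ ^ m * c ∂μ = 0 := by
      rw [integral_mul_const, ← zero_mul c]
      congr 1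
      exact setIntegral_annulus_mul_comp_norm_eq_zero μ hw0 hmean (fun r => (r ^ m)⁻¹) 1 2
    simp_rw [mul_sub]
    rw [integral_sub (integrableOn_annulus_div_norm_pow_mul μ hw hw0 hint hgc m one_pos 2)
      (integrableOn_annulus_div_norm_pow_mul μ hw hw0 hint continuous_const m one_pos 2),
      h0, sub_zero]
  calc ‖∫ y in A, w y / ‖y‖ ^ m * g y ∂μ‖ₑ
      ≤ ∫⁻ y in A, ‖w y / ‖y‖ ^ m * (g y - c)‖ₑ ∂μ := by
        rw [hsub]
        exact enorm_integral_le_lintegral_enorm _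
    _ ≤ ∫⁻ y in A, ‖w y‖ₑ * ‖g y - c‖ₑ ∂μ := by
        refine setLIntegral_mono' hA fun y hy => ?_
        rw [enorm_mul]
        gcongr
        rw [enorm_le_iff_norm_le, norm_div, norm_pow, norm_norm]
        exact div_le_self (norm_nonneg _) (one_le_pow₀ hy.1.le)
    _ ≤ (∫⁻ y in A, ‖w y‖ₑ ^ ρ ∂μ) ^ (1 / ρ) *
          (∫⁻ y in A, ‖g y - c‖ₑ ^ ρ.conjExponent ∂μ) ^ (1 / ρ.conjExponent) :=
        ENNReal.lintegral_mul_le_Lp_mul_Lq _ hconj hw.enorm.aemeasurable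
          (Continuous.enorm (by fun_prop)).measurable.aemeasurable
    _ ≤ ((∫⁻ z : sphere (0 : E) 1, ‖w z‖ₑ ^ ρ ∂μ.toSphere) ^ (1 / ρ) * V) *
          (K * (∫⁻ y in ball 0 4, ‖fderiv ℝ g y‖ₑ ^ α ∂μ) ^ (1 / α)) := by
        gcongr
        · rw [setLIntegral_annulus_eq μ (hw.enorm.pow_const ρ) fun c hc y => by rw [hw0 c hc],
            ENNReal.mul_rpow_of_nonneg _ _ (by positivity)]
        · refine le_trans ?_ hc
          refine ENNReal.rpow_le_rpow (lintegral_mono_set fun y hy => ?_)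
            (one_div_nonneg.2 hconj.symm.nonneg)
          simpa using hy.2
    _ = _ := by ring

theorem exists_enorm_setIntegral_annulus_le {ρ α : ℝ} (hρ : 1 < ρ) (hα : 1 ≤ α)
    (hαn : α < finrank ℝ E) (hαρ : α⁻¹ - (finrank ℝ E : ℝ)⁻¹ ≤ 1 - ρ⁻¹) :
    ∃ C : NNReal, ∀ w : E → ℝ, Measurable w →
      (∀ c : ℝ, 0 < c → ∀ y, w (c • y) = w y) →
      Integrable (fun z : sphere (0 : E) 1 => w z) μ.toSphere →
      ∫ z : sphere (0 : E) 1, w z ∂μ.toSphere = 0 →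
      ∀ f : E → ℝ, ContDiff ℝ 1 f → ∀ (x : E) (r : ℝ), 0 < r →
      ‖∫ y in {y | ‖y‖ ∈ Ioc r (2 * r)}, w y / ‖y‖ ^ finrank ℝ E * f (x - y) ∂μ‖ₑ ≤
        C * (∫⁻ z : sphere (0 : E) 1, ‖w z‖ₑ ^ ρ ∂μ.toSphere) ^ (1 / ρ) *
          (ENNReal.ofReal r * (ENNReal.ofReal ((r ^ finrank ℝ E)⁻¹) *
            ∫⁻ y in ball x (4 * r), ‖fderiv ℝ f y‖ₑ ^ α ∂μ) ^ (1 / α)) := by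
  obtain ⟨C, hC⟩ := exists_enorm_setIntegral_unit_annulus_le μ hρ hα hαn hαρ (finrank ℝ E)
  refine ⟨C, fun w hw hw0 hint hmean f hf x r hr => ?_⟩
  have hα0 : 0 < α := by linarith
  set n := finrank ℝ E
  have hg : ContDiff ℝ 1 fun z => f (x - r • z) := hf.comp (by fun_prop)
  have hd : ∀ z, ‖fderiv ℝ (fun z => f (x - r • z)) z‖ₑ ^ α =
      ENNReal.ofReal r ^ α * ‖fderiv ℝ f (x - r • z)‖ₑ ^ α := by
    intro z
    have h1 : HasFDerivAt (fun z : E => x - r • z) (-(r • ContinuousLinearMap.id ℝ E)) z :=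
      ((hasFDerivAt_id z).const_smul r).const_sub x
    have h2 := (((hf.differentiable one_ne_zero) (x - r • z)).hasFDerivAt.comp z h1).fderiv
    have h3 : (fderiv ℝ f (x - r • z)).comp (-(r • ContinuousLinearMap.id ℝ E)) =
        (-r) • fderiv ℝ f (x - r • z) := by
      ext v
      simp
    rw [h3] at h2
    rw [← ENNReal.mul_rpow_of_nonneg _ _ hα0.le]
    congr 1
    change ‖fderiv ℝ (f ∘ fun z => x - r • z) z‖ₑ = _
    rw [h2, enorm_smul, enorm_neg, Real.enorm_of_nonneg hr.le]
  have hset : {y : E | ‖y‖ ∈ Ioc r (2 * r)} = r • {y : E | ‖y‖ ∈ Ioc (1 : ℝ) 2} := by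
    ext y
    rw [mem_smul_set_iff_inv_smul_mem₀ hr.ne']
    simp only [mem_ofPred_eq, mem_Ioc, norm_smul, norm_inv, Real.norm_of_nonneg hr.le]
    rw [lt_inv_mul_iff₀ hr, inv_mul_le_iff₀ hr, mul_one, mul_comm 2 r]
  have hint_eq : ∫ y in {y : E | ‖y‖ ∈ Ioc r (2 * r)}, w y / ‖y‖ ^ n * f (x - y) ∂μ =
      ∫ y in {y : E | ‖y‖ ∈ Ioc (1 : ℝ) 2}, w y / ‖y‖ ^ n * f (x - r • y) ∂μ := by
    have h := Measure.setIntegral_comp_smul_of_pos μ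
      (fun y => w y / ‖y‖ ^ n * f (x - y)) {y : E | ‖y‖ ∈ Ioc (1 : ℝ) 2} hr
    rw [← hset, eq_inv_smul_iff₀ (by positivity), smul_eq_mul, ← integral_const_mul] at h
    rw [← h]
    congr 1 with y
    rw [hw0 r hr, norm_smul, Real.norm_of_nonneg hr.le, mul_pow]
    change r ^ n * _ = _
    field_simp
  have hball : ∫⁻ y in ball 0 4, ‖fderiv ℝ f (x - r • y)‖ₑ ^ α ∂μ =
      ENNReal.ofReal ((r ^ n)⁻¹) * ∫⁻ y in ball x (4 * r), ‖fderiv ℝ f y‖ₑ ^ α ∂μ := by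
    set h : E → ℝ≥0∞ := (ball x (4 * r)).indicator fun y => ‖fderiv ℝ f y‖ₑ ^ α
    have hm : Measurable h :=
      ((hf.continuous_fderiv one_ne_zero).enorm.measurable.pow_const α).indicator
        measurableSet_ball
    rw [← lintegral_indicator measurableSet_ball, ← lintegral_indicator measurableSet_ball]
    change _ = _ * ∫⁻ y, h y ∂μ
    rw [← lintegral_sub_left_eq_self h x, ← abs_of_pos (a := (r ^ n)⁻¹) (by positivity),
      ← lintegral_comp_smul_addHaar μ (h := fun y => h (x - y))
        (hm.comp (measurable_const_sub x)) hr.ne']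
    congr 1 with y
    have hiff : x - r • y ∈ ball x (4 * r) ↔ y ∈ ball (0 : E) 4 := by
      rw [mem_ball_iff_norm, mem_ball_zero_iff, sub_sub_cancel_left, norm_neg, norm_smul,
        Real.norm_of_nonneg hr.le, mul_comm, mul_lt_mul_iff_left₀ hr]
    by_cases hy : y ∈ ball (0 : E) 4
    · simp only [h]
      rw [indicator_of_mem hy, indicator_of_mem (hiff.2 hy)]
    · simp only [h]
      rw [indicator_of_notMem hy, indicator_of_notMem fun h' => hy (hiff.1 h')]
  refine hint_eq ▸ (hC w hw hw0 hint hmean _ hg).trans (le_of_eq ?_)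
  simp_rw [hd]
  rw [lintegral_const_mul' _ _ (ENNReal.rpow_ne_top_of_nonneg hα0.le ENNReal.ofReal_ne_top),
    hball, ENNReal.mul_rpow_of_nonneg _ _ (by positivity), ← ENNReal.rpow_mul,
    mul_one_div_cancel hα0.ne', ENNReal.rpow_one]

end Annulus

section Dyadic

theorem sum_dyadic_le {γ : ℝ} (hγ : 1 < γ) {s : ℝ} (hs : 0 < s) (J : ℕ) :
    ∑ j ∈ Finset.range J, min (2 ^ j * s) ((2 ^ j * s) ^ (1 - γ)) ≤
      2 + (1 - 2 ^ (1 - γ))⁻¹ := by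
  have h2 : (2 : ℝ) ^ (1 - γ) < 1 := Real.rpow_lt_one_of_one_lt_of_neg one_lt_two (by linarith)
  have h2' : 0 < 1 - (2 : ℝ) ^ (1 - γ) := by linarith
  set D := (1 - (2 : ℝ) ^ (1 - γ))⁻¹
  have hD : 0 < D := inv_pos.2 h2'
  let Φ : ℝ → ℝ := fun u => min u 2 - D * min 1 (u ^ (1 - γ))
  have hstep : ∀ u : ℝ, 0 < u → min u (u ^ (1 - γ)) ≤ Φ (2 * u) - Φ u := by
    intro u hu
    have hmono : (2 * u) ^ (1 - γ) ≤ u ^ (1 - γ) :=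
      Real.rpow_le_rpow_of_nonpos hu (by linarith) (by linarith)
    have hfst : min u 2 ≤ min (2 * u) 2 := min_le_min_right _ (by linarith)
    have hsnd : D * min 1 ((2 * u) ^ (1 - γ)) ≤ D * min 1 (u ^ (1 - γ)) := by gcongr
    rcases le_total u 1 with h | h
    · have h1 : min (2 * u) 2 = 2 * u := min_eq_left (by linarith)
      have h3 : min u 2 = u := min_eq_left (by linarith)
      have := min_le_left u (u ^ (1 - γ))
      simp only [Φ]
      linarith
    · have h1 : u ^ (1 - γ) ≤ 1 := Real.rpow_le_one_of_one_le_of_nonpos h (by linarith)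
      have h3 : D * min 1 (u ^ (1 - γ)) - D * min 1 ((2 * u) ^ (1 - γ)) = u ^ (1 - γ) := by
        rw [min_eq_right h1, min_eq_right (hmono.trans h1), Real.mul_rpow two_pos.le hu.le,
          show D * u ^ (1 - γ) - D * (2 ^ (1 - γ) * u ^ (1 - γ)) =
            D * (1 - 2 ^ (1 - γ)) * u ^ (1 - γ) by ring, inv_mul_cancel₀ h2'.ne', one_mul]
      have := min_le_right u (u ^ (1 - γ))
      simp only [Φ]
      linarith
  calc ∑ j ∈ Finset.range J, min (2 ^ j * s) ((2 ^ j * s) ^ (1 - γ))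
      ≤ ∑ j ∈ Finset.range J, (Φ (2 ^ (j + 1) * s) - Φ (2 ^ j * s)) := by
        refine Finset.sum_le_sum fun j _ => ?_
        rw [pow_succ', mul_assoc]
        exact hstep _ (by positivity)
    _ = Φ (2 ^ J * s) - Φ (2 ^ 0 * s) := Finset.sum_range_sub (fun j => Φ (2 ^ j * s)) J
    _ ≤ 2 + D := by
        have h1 : Φ (2 ^ J * s) ≤ 2 :=
          (sub_le_self _ (by positivity)).trans (min_le_right _ _)
        have h3 : -D ≤ Φ (2 ^ 0 * s) := by
          have h4 : D * min 1 ((2 ^ 0 * s) ^ (1 - γ)) ≤ D :=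
            mul_le_of_le_one_right hD.le (min_le_left _ _)
          have h5 : 0 ≤ min (2 ^ 0 * s) 2 := by positivity
          simp only [Φ]
          linarith
        linarith

theorem sum_dyadic_mul_min_le {γ : ℝ} (hγ : 1 < γ) {t : ℝ} (ht : 0 < t) (A N : ℝ≥0∞) (J : ℕ) :
    ∑ j ∈ Finset.range J, ENNReal.ofReal (2 ^ j * t) *
        min A (ENNReal.ofReal ((2 ^ j * t) ^ (-γ)) * N) ≤
      ENNReal.ofReal (2 + (1 - 2 ^ (1 - γ))⁻¹) * A ^ (1 - γ⁻¹) * N ^ γ⁻¹ := by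
  have hγ0 : 0 < γ := by linarith
  have hγi : 0 < γ⁻¹ := inv_pos.2 hγ0
  have hγi' : 0 < 1 - γ⁻¹ := by rw [sub_pos]; exact inv_lt_one_of_one_lt₀ hγ
  have h2 : (2 : ℝ) ^ (1 - γ) < 1 := Real.rpow_lt_one_of_one_lt_of_neg one_lt_two (by linarith)
  have hD : 0 < 2 + (1 - (2 : ℝ) ^ (1 - γ))⁻¹ := by
    have : 0 < (1 - (2 : ℝ) ^ (1 - γ))⁻¹ := inv_pos.2 (by linarith)
    linarith
  have hD' : ENNReal.ofReal (2 + (1 - (2 : ℝ) ^ (1 - γ))⁻¹) ≠ 0 := by simpa using hD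
  rcases eq_or_ne A 0 with rfl | hA
  · simp
  rcases eq_or_ne N 0 with rfl | hN
  · simp
  rcases eq_or_ne A ∞ with rfl | hA'
  · rw [ENNReal.top_rpow_of_pos hγi', ENNReal.mul_top hD', ENNReal.top_mul]
    · exact le_top
    · simp [ENNReal.rpow_eq_zero_iff, hN, hγ0.le]
  rcases eq_or_ne N ∞ with rfl | hN'
  · rw [ENNReal.top_rpow_of_pos hγi, ENNReal.mul_top]
    · exact le_top
    · simp [ENNReal.rpow_eq_zero_iff, hA, hA', hD]
  lift A to NNReal using hA'
  lift N to NNReal using hN'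
  have hA0 : (0 : ℝ) < A := by simpa [pos_iff_ne_zero] using hA
  have hN0 : (0 : ℝ) < N := by simpa [pos_iff_ne_zero] using hN
  set a : ℝ := (A : ℝ)
  set b : ℝ := (N : ℝ)
  have hAe : (A : ℝ≥0∞) = ENNReal.ofReal a := (ENNReal.ofReal_coe_nnreal).symm
  have hNe : (N : ℝ≥0∞) = ENNReal.ofReal b := (ENNReal.ofReal_coe_nnreal).symm
  set R : ℝ := (b / a) ^ γ⁻¹
  have hR : 0 < R := by positivity
  have hRγ : R ^ γ = b / a := Real.rpow_inv_rpow (by positivity) hγ0.ne'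
  have hterm : ∀ r : ℝ, 0 < r → r * min a (r ^ (-γ) * b) =
      a * R * min (r / R) ((r / R) ^ (1 - γ)) := by
    intro r hr
    have hrR : (r / R) ^ (1 - γ) = r / R * (r ^ (-γ) * (b / a)) := by
      rw [show (1 - γ) = 1 + -γ by ring, Real.rpow_add (by positivity), Real.rpow_one,
        Real.div_rpow hr.le hR.le, Real.rpow_neg hR.le, hRγ, div_inv_eq_mul]
    rw [hrR, mul_min_of_nonneg _ _ hr.le, mul_min_of_nonneg _ _ (by positivity)]
    congr 1
    · field_simp
    · field_simp
  have hAR : a * R = a ^ (1 - γ⁻¹) * b ^ γ⁻¹ := by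
    have hRe : R = b ^ γ⁻¹ / a ^ γ⁻¹ := Real.div_rpow hN0.le hA0.le _
    rw [hRe, Real.rpow_sub hA0, Real.rpow_one]
    ring
  rw [hAe, hNe, ENNReal.ofReal_rpow_of_pos hA0, ENNReal.ofReal_rpow_of_pos hN0,
    ← ENNReal.ofReal_mul hD.le, ← ENNReal.ofReal_mul (by positivity)]
  calc ∑ j ∈ Finset.range J, ENNReal.ofReal (2 ^ j * t) *
        min (ENNReal.ofReal a) (ENNReal.ofReal ((2 ^ j * t) ^ (-γ)) * ENNReal.ofReal b)
      = ENNReal.ofReal (∑ j ∈ Finset.range J,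
          a * R * min (2 ^ j * (t / R)) ((2 ^ j * (t / R)) ^ (1 - γ))) := by
        rw [ENNReal.ofReal_sum_of_nonneg fun j _ => by positivity]
        refine Finset.sum_congr rfl fun j _ => ?_
        rw [← ENNReal.ofReal_mul (by positivity), ← ENNReal.ofReal_min,
          ← ENNReal.ofReal_mul (by positivity), hterm _ (by positivity), mul_div_assoc]
    _ ≤ _ := by
        refine ENNReal.ofReal_le_ofReal ?_
        rw [← Finset.mul_sum, mul_assoc (2 + _), ← hAR, mul_comm (2 + _)]
        gcongr
        exact sum_dyadic_le hγ (by positivity) J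

theorem setIntegral_annulus_eq_sum {E : Type*} [NormedAddCommGroup E] [MeasurableSpace E]
    [BorelSpace E] {μ : Measure E} {F : E → ℝ} {t : ℝ} (ht : 0 < t)
    (hF : ∀ a b : ℝ, 0 < a → IntegrableOn F {y | ‖y‖ ∈ Ioc a b} μ) (J : ℕ) :
    ∫ y in {y | ‖y‖ ∈ Ioc t (2 ^ J * t)}, F y ∂μ =
      ∑ j ∈ Finset.range J, ∫ y in {y | ‖y‖ ∈ Ioc (2 ^ j * t) (2 * (2 ^ j * t))}, F y ∂μ := by
  induction J with
  | zero => simp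
  | succ J ih =>
    have hun : {y : E | ‖y‖ ∈ Ioc t (2 ^ (J + 1) * t)} =
        {y | ‖y‖ ∈ Ioc t (2 ^ J * t)} ∪ {y | ‖y‖ ∈ Ioc (2 ^ J * t) (2 * (2 ^ J * t))} := by
      have h1 : t ≤ 2 ^ J * t := le_mul_of_one_le_left ht.le (one_le_pow₀ one_le_two)
      have h3 : 2 ^ J * t ≤ 2 * (2 ^ J * t) := by linarith
      rw [pow_succ', mul_assoc, ← Ioc_union_Ioc_eq_Ioc h1 h3]
      rfl
    rw [Finset.sum_range_succ, ← ih, hun, setIntegral_union _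
      (measurableSet_norm_preimage_Ioc _ _) (hF _ _ ht) (hF _ _ (by positivity))]
    exact disjoint_left.2 fun y hy hy' => hy.2.not_gt hy'.1

theorem enorm_setIntegral_lt_norm_le_of_dyadic {E : Type*} [NormedAddCommGroup E]
    [MeasurableSpace E] [BorelSpace E] {μ : Measure E} {F : E → ℝ} {t : ℝ} (ht : 0 < t)
    (hF : ∀ a b : ℝ, 0 < a → IntegrableOn F {y | ‖y‖ ∈ Ioc a b} μ) {R : ℝ}
    (hR : ∀ y, R < ‖y‖ → F y = 0) {B : ℝ≥0∞}
    (hB : ∀ J : ℕ, ∑ j ∈ Finset.range J,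
      ‖∫ y in {y | ‖y‖ ∈ Ioc (2 ^ j * t) (2 * (2 ^ j * t))}, F y ∂μ‖ₑ ≤ B) :
    ‖∫ y in {y | t < ‖y‖}, F y ∂μ‖ₑ ≤ B := by
  obtain ⟨J, hJ⟩ := pow_unbounded_of_one_lt (R / t) one_lt_two
  rw [div_lt_iff₀ ht] at hJ
  have h : ∫ y in {y | t < ‖y‖}, F y ∂μ = ∫ y in {y | ‖y‖ ∈ Ioc t (2 ^ J * t)}, F y ∂μ := by
    refine setIntegral_eq_of_subset_of_forall_sdiff_eq_zero
      (measurableSet_lt measurable_const measurable_norm) (fun y hy => hy.1) fun y hy => hR y ?_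
    have : ¬ ‖y‖ ≤ 2 ^ J * t := fun h => hy.2 ⟨hy.1, h⟩
    linarith
  rw [h, setIntegral_annulus_eq_sum ht hF]
  exact (enorm_sum_le _ _).trans (hB J)

end Dyadic

theorem setLIntegral_rpow_le_maximalFn {n : ℕ} {α : ℝ} (G : EuclideanSpace ℝ (Fin n) → ℝ)
    (x : EuclideanSpace ℝ (Fin n)) {s : ℝ} (hs : 0 < s) (hG : ∀ y, 0 ≤ G y) :
    ∫⁻ y in ball x s, ENNReal.ofReal (G y ^ α) ≤
      volume (ball x s) * maximalFn n (fun y => G y ^ α) x := by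
  have h : (volume (ball x s))⁻¹ * ∫⁻ y in ball x s, ENNReal.ofReal |G y ^ α| ≤
      maximalFn n (fun y => G y ^ α) x :=
    le_iSup₂_of_le x s (le_iSup₂_of_le hs (mem_ball_self hs) le_rfl)
  rw [ENNReal.inv_mul_le_iff (measure_ball_pos _ _ hs).ne' measure_ball_lt_top.ne] at h
  simpa only [abs_of_nonneg (Real.rpow_nonneg (hG _) α)] using h

theorem setLIntegral_rpow_le_morreyNorm {n : ℕ} {p q : ℝ} (hp : 0 < p)
    (G : EuclideanSpace ℝ (Fin n) → ℝ) (x : EuclideanSpace ℝ (Fin n)) {s : ℝ} (hs : 0 < s) :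
    ∫⁻ y in ball x s, ENNReal.ofReal (|G y| ^ p) ≤
      ENNReal.ofReal (s ^ (n * (1 - p / q))) * morreyNorm n p q G ^ p := by
  have h : (ENNReal.ofReal (s ^ (-(n * (1 - p / q)))) *
      ∫⁻ y in ball x s, ENNReal.ofReal (|G y| ^ p)) ^ (1 / p) ≤ morreyNorm n p q G :=
    le_iSup₂_of_le x s (le_iSup_of_le hs le_rfl)
  rw [one_div, ENNReal.rpow_inv_le_iff hp, Real.rpow_neg hs.le,
    ENNReal.ofReal_inv_of_pos (by positivity)] at h
  have hs0 : ENNReal.ofReal (s ^ (n * (1 - p / q))) ≠ 0 := by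
    simpa using Real.rpow_pos_of_pos hs _
  rwa [ENNReal.inv_mul_le_iff hs0 ENNReal.ofReal_ne_top] at h

theorem exists_average_fderiv_le_min {n : ℕ} (hn : 0 < n) {α β : ℝ} (hα : 0 < α) :
    ∃ K : NNReal, ∀ (f : EuclideanSpace ℝ (Fin n) → ℝ) (x : EuclideanSpace ℝ (Fin n)) (r : ℝ),
      0 < r →
      (ENNReal.ofReal ((r ^ n)⁻¹) * ∫⁻ y in ball x (4 * r), ‖fderiv ℝ f y‖ₑ ^ α) ^ (1 / α) ≤
        K * min (maximalFn n (fun y => ‖fderiv ℝ f y‖ ^ α) x ^ (1 / α))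
          (ENNReal.ofReal (r ^ (-(β / α))) *
            morreyNorm n α (α * n / β) (fun y => ‖fderiv ℝ f y‖)) := by
  have hn0 : (n : ℝ) ≠ 0 := by positivity
  set v := volume (ball (0 : EuclideanSpace ℝ (Fin n)) 1)
  have hv : v ≠ ∞ := measure_ball_lt_top.ne
  have hK₁ : (ENNReal.ofReal (4 ^ n) * v) ^ (1 / α) ≠ ∞ :=
    ENNReal.rpow_ne_top_of_nonneg (by positivity) (ENNReal.mul_ne_top ENNReal.ofReal_ne_top hv)
  have hK₂ : ENNReal.ofReal (4 ^ (n - β)) ^ (1 / α) ≠ ∞ :=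
    ENNReal.rpow_ne_top_of_nonneg (by positivity) ENNReal.ofReal_ne_top
  refine ⟨max ((ENNReal.ofReal (4 ^ n) * v) ^ (1 / α)).toNNReal
    (ENNReal.ofReal (4 ^ (n - β)) ^ (1 / α)).toNNReal, fun f x r hr => ?_⟩
  have he : ∀ y, ‖fderiv ℝ f y‖ₑ ^ α = ENNReal.ofReal (‖fderiv ℝ f y‖ ^ α) := fun y => by
    rw [← ofReal_norm, ENNReal.ofReal_rpow_of_nonneg (norm_nonneg _) hα.le]
  simp_rw [he]
  rw [ENNReal.coe_max, ENNReal.coe_toNNReal hK₁, ENNReal.coe_toNNReal hK₂, mul_min]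
  refine le_min ?_ ?_
  · refine le_trans ?_ (mul_le_mul_left (le_max_left _ _) _)
    rw [← ENNReal.mul_rpow_of_nonneg _ _ (by positivity)]
    refine ENNReal.rpow_le_rpow ?_ (by positivity)
    calc ENNReal.ofReal ((r ^ n)⁻¹) *
          ∫⁻ y in ball x (4 * r), ENNReal.ofReal (‖fderiv ℝ f y‖ ^ α)
        ≤ ENNReal.ofReal ((r ^ n)⁻¹) * (volume (ball x (4 * r)) *
            maximalFn n (fun y => ‖fderiv ℝ f y‖ ^ α) x) := by
          gcongr
          exact setLIntegral_rpow_le_maximalFn _ x (by positivity) fun y => norm_nonneg _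
      _ = _ := by
          rw [Measure.addHaar_ball_of_pos _ _ (by positivity), finrank_euclideanSpace_fin,
            ← mul_assoc, ← mul_assoc, ← ENNReal.ofReal_mul (by positivity)]
          congr 4
          rw [mul_pow]
          field_simp
  · refine le_trans ?_ (mul_le_mul_left (le_max_right _ _) _)
    calc (ENNReal.ofReal ((r ^ n)⁻¹) *
          ∫⁻ y in ball x (4 * r), ENNReal.ofReal (‖fderiv ℝ f y‖ ^ α)) ^ (1 / α)
        ≤ (ENNReal.ofReal ((r ^ n)⁻¹) * (ENNReal.ofReal ((4 * r) ^ (n - β)) *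
            morreyNorm n α (α * n / β) (fun y => ‖fderiv ℝ f y‖) ^ α)) ^ (1 / α) := by
          gcongr
          have h := setLIntegral_rpow_le_morreyNorm (q := α * n / β) hα
            (fun y => ‖fderiv ℝ f y‖) x (s := 4 * r) (by positivity)
          have hexp : (n : ℝ) * (1 - α / (α * n / β)) = n - β := by field_simp
          simpa only [hexp, abs_norm] using h
      _ = _ := by
          rw [← mul_assoc, ENNReal.mul_rpow_of_nonneg _ _ (by positivity), ← ENNReal.rpow_mul,
            mul_one_div_cancel hα.ne', ENNReal.rpow_one, ← mul_assoc,
            ← ENNReal.ofReal_mul (by positivity), ENNReal.ofReal_rpow_of_pos (by positivity),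
            ENNReal.ofReal_rpow_of_pos (by positivity), ← ENNReal.ofReal_mul (by positivity)]
          congr 2
          have h1 : (r ^ n)⁻¹ * (4 * r) ^ ((n : ℝ) - β) = 4 ^ ((n : ℝ) - β) * r ^ (-β) := by
            rw [Real.mul_rpow (by norm_num) hr.le, Real.rpow_sub hr, Real.rpow_natCast,
              Real.rpow_neg hr.le]
            field_simp
          rw [h1, Real.mul_rpow (by positivity) (by positivity), ← Real.rpow_mul hr.le]
          congr 2
          ring

/-- Theorem 1 of the paper: with `Ω ∈ L^ρ(𝕊^{n-1})` mean zero (`1 < ρ < n`),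
`ρn/(ρn+ρ-n) ≤ α < n`, `1 < α < β < n`, for `f ∈ C_c^∞(ℝⁿ)` and all `x`:
`|T_Ω f(x)| ≤ C ‖Ω‖_{L^ρ(𝕊^{n-1})} (M_B(|∇f|^α)(x))^{1/α-1/β} ‖∇f‖_{Ṁ^{α,αn/β}}^{α/β}`. -/
theorem pointwise_maximal_morrey_bound (n : ℕ) (hn : 2 ≤ n) (ρ α β : ℝ) (hρ : 1 < ρ)
    (hρn : ρ < n) (hα₁ : ρ * n / (ρ * n + ρ - n) ≤ α) (hα₂ : α < n) (hα : 1 < α)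
    (hαβ : α < β) (hβ : β < n) :
    ∃ C : ℝ, 0 < C ∧
      ∀ (Ω : EuclideanSpace ℝ (Fin n) → ℝ), Measurable Ω →
        (∀ c : ℝ, 0 < c → ∀ y, Ω (c • y) = Ω y) →
        Integrable (fun z : sphere (0 : EuclideanSpace ℝ (Fin n)) 1 => Ω (z : EuclideanSpace ℝ (Fin n)))
          ((volume : Measure (EuclideanSpace ℝ (Fin n))).toSphere) →
        (∫ z : sphere (0 : EuclideanSpace ℝ (Fin n)) 1, Ω (z : EuclideanSpace ℝ (Fin n))
            ∂((volume : Measure (EuclideanSpace ℝ (Fin n))).toSphere)) = 0 →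
      ∀ (f : EuclideanSpace ℝ (Fin n) → ℝ), ContDiff ℝ (⊤ : ℕ∞) f → HasCompactSupport f →
      ∀ (x : EuclideanSpace ℝ (Fin n)) (L : ℝ),
        Tendsto (fun t : ℝ =>
            ∫ y in {y : EuclideanSpace ℝ (Fin n) | t < ‖y‖}, (Ω y / ‖y‖ ^ n) * f (x - y))
          (nhdsWithin 0 (Ioi 0)) (nhds L) →
        ENNReal.ofReal |L| ≤
          ENNReal.ofReal C *
            ((∫⁻ z : sphere (0 : EuclideanSpace ℝ (Fin n)) 1,
                ENNReal.ofReal (|Ω (z : EuclideanSpace ℝ (Fin n))| ^ ρ)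
                ∂((volume : Measure (EuclideanSpace ℝ (Fin n))).toSphere)) ^ (1 / ρ)) *
            (maximalFn n (fun y => ‖fderiv ℝ f y‖ ^ α) x) ^ (1 / α - 1 / β) *
            (morreyNorm n α (α * n / β) (fun y => ‖fderiv ℝ f y‖)) ^ (α / β) := by
  have hn0 : 0 < n := by omega
  have hnR : (0 : ℝ) < n := by positivity
  have hρ0 : 0 < ρ := by linarith
  have hα0 : 0 < α := by linarith
  have hβ0 : 0 < β := by linarith
  have : Nonempty (Fin n) := ⟨⟨0, hn0⟩⟩
  have hαρ : α⁻¹ - (n : ℝ)⁻¹ ≤ 1 - ρ⁻¹ := by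
    have hd : 0 < ρ * n + ρ - n := by nlinarith
    have h := inv_anti₀ (by positivity) hα₁
    have h1 : (ρ * n / (ρ * n + ρ - n))⁻¹ = 1 + (n : ℝ)⁻¹ - ρ⁻¹ := by field_simp
    linarith
  obtain ⟨C, hC⟩ := exists_enorm_setIntegral_annulus_le
    (volume : Measure (EuclideanSpace ℝ (Fin n))) (α := α) hρ hα.le
    (by rwa [finrank_euclideanSpace_fin]) (by rwa [finrank_euclideanSpace_fin])
  simp only [finrank_euclideanSpace_fin] at hC
  obtain ⟨K, hK⟩ := exists_average_fderiv_le_min hn0 hα0 (β := β)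
  have hγ : 1 < β / α := by rwa [one_lt_div hα0]
  have hD : 0 < 2 + (1 - (2 : ℝ) ^ (1 - β / α))⁻¹ := by
    have h := Real.rpow_lt_one_of_one_lt_of_neg one_lt_two (by linarith : 1 - β / α < 0)
    have := inv_pos.2 (sub_pos.2 h)
    linarith
  set D := 2 + (1 - (2 : ℝ) ^ (1 - β / α))⁻¹
  refine ⟨(C * K + 1) * D, by positivity, ?_⟩
  intro Ω hΩ hΩ0 hint hmean f hf hfc x L hL
  have hf1 : ContDiff ℝ 1 f := hf.of_le (mod_cast le_top)
  have hW : ∀ z : sphere (0 : EuclideanSpace ℝ (Fin n)) 1,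
      ENNReal.ofReal (|Ω z| ^ ρ) = ‖Ω z‖ₑ ^ ρ := fun z => by
    rw [← ofReal_norm, ENNReal.ofReal_rpow_of_nonneg (norm_nonneg _) hρ0.le, Real.norm_eq_abs]
  simp_rw [hW]
  rw [← Real.norm_eq_abs, ofReal_norm]
  set W := (∫⁻ z : sphere (0 : EuclideanSpace ℝ (Fin n)) 1, ‖Ω z‖ₑ ^ ρ
    ∂((volume : Measure (EuclideanSpace ℝ (Fin n))).toSphere)) ^ (1 / ρ)
  set M := maximalFn n (fun y => ‖fderiv ℝ f y‖ ^ α) x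
  set N := morreyNorm n α (α * n / β) (fun y => ‖fderiv ℝ f y‖)
  obtain ⟨R, hR⟩ := hfc.isCompact.isBounded.subset_closedBall x
  refine le_of_tendsto hL.enorm ?_
  filter_upwards [self_mem_nhdsWithin] with t ht
  refine enorm_setIntegral_lt_norm_le_of_dyadic
    (F := fun y => Ω y / ‖y‖ ^ n * f (x - y)) (R := R) ht (fun a b ha =>
    integrableOn_annulus_div_norm_pow_mul _ hΩ hΩ0 hint (hf.continuous.comp (by fun_prop)) n ha b)
    (fun y hy => ?_) fun J => ?_
  · have hxy : f (x - y) = 0 := by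
      refine image_eq_zero_of_notMem_tsupport fun h => ?_
      have := hR h
      rw [mem_closedBall_iff_norm, sub_sub_cancel_left, norm_neg] at this
      linarith
    rw [hxy, mul_zero]
  have ht0 : 0 < t := ht
  calc ∑ j ∈ Finset.range J, ‖∫ y in {y | ‖y‖ ∈ Ioc (2 ^ j * t) (2 * (2 ^ j * t))},
        Ω y / ‖y‖ ^ n * f (x - y)‖ₑ
      ≤ ∑ j ∈ Finset.range J, C * W * (ENNReal.ofReal (2 ^ j * t) * (K * min (M ^ (1 / α))
          (ENNReal.ofReal ((2 ^ j * t) ^ (-(β / α))) * N))) := by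
        refine Finset.sum_le_sum fun j _ => ?_
        have hr : 0 < 2 ^ j * t := by positivity
        refine (hC Ω hΩ hΩ0 hint hmean f hf1 x _ hr).trans ?_
        gcongr
        exact hK f x _ hr
    _ = C * K * W * ∑ j ∈ Finset.range J, ENNReal.ofReal (2 ^ j * t) * min (M ^ (1 / α))
          (ENNReal.ofReal ((2 ^ j * t) ^ (-(β / α))) * N) := by
        rw [Finset.mul_sum]
        refine Finset.sum_congr rfl fun j _ => ?_
        ring
    _ ≤ C * K * W * (ENNReal.ofReal D * (M ^ (1 / α)) ^ (1 - (β / α)⁻¹) * N ^ (β / α)⁻¹) := by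
        gcongr
        exact sum_dyadic_mul_min_le hγ ht0 _ _ J
    _ = C * K * ENNReal.ofReal D * W * M ^ (1 / α - 1 / β) * N ^ (α / β) := by
        rw [← ENNReal.rpow_mul, inv_div,
          show 1 / α * (1 - α / β) = 1 / α - 1 / β by field_simp]
        ring
    _ ≤ _ := by
        gcongr
        rw [ENNReal.ofReal_mul (by positivity)]
        gcongr
        rw [ENNReal.ofReal_add (by positivity) zero_le_one, ENNReal.ofReal_mul (by positivity),
          ENNReal.ofReal_coe_nnreal, ENNReal.ofReal_coe_nnreal]
        exact le_self_add
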